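/- Let n ≥ 2 and let U ⊂ ℝⁿ be a bounded connected open set whose boundary ∂U is connected and is a C^∞ embedded (n−1)-dimensional submanifold of ℝⁿ. Let B be an open ball containing the closure of U. Then there exists a finite open cover U₀, U₁, …, U_m of B such that: each U_j is diffeomorphic to the open cube (0,1)ⁿ, each U_j has nonempty intersection with ∂U, and each intersection U_j ∩ ∂U is diffeomorphic to (0,1)^(n−1). -/

import Mathlib

open Set

/-- A set `M ⊆ ℝⁿ` is a `C^∞` embedded hypersurface if near each of its points it is the
zero set of a smooth function with nonvanishing derivative. -/
def IsSmoothHypersurface {n : ℕ} (M : Set (Fin n → ℝ)) : Prop :=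
  ∀ x ∈ M, ∃ V : Set (Fin n → ℝ), IsOpen V ∧ x ∈ V ∧
    ∃ F : (Fin n → ℝ) → ℝ, ContDiff ℝ (⊤ : ℕ∞) F ∧ (∀ y ∈ V, fderiv ℝ F y ≠ 0) ∧
      M ∩ V = {y ∈ V | F y = 0}

/-- Two subsets of Euclidean spaces are diffeomorphic: there are mutually inverse maps
between them, each smooth on the respective set. -/
def SetDiffeo {a b : ℕ} (s : Set (Fin a → ℝ)) (t : Set (Fin b → ℝ)) : Prop :=
  ∃ (F : (Fin a → ℝ) → Fin b → ℝ) (G : (Fin b → ℝ) → Fin a → ℝ),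
    ContDiffOn ℝ (⊤ : ℕ∞) F s ∧ ContDiffOn ℝ (⊤ : ℕ∞) G t ∧ Set.MapsTo F s t ∧ Set.MapsTo G t s ∧
    Set.InvOn G F s t

/-- The open unit cube `(0,1)^d`. -/
def unitOpenCube (d : ℕ) : Set (Fin d → ℝ) := {x | ∀ i, x i ∈ Set.Ioo (0:ℝ) 1}

/-- An injective continuous endomorphism of a finite-dimensional space is a continuous linear
equivalence. -/
theorem exists_continuousLinearEquiv_of_ker {E : Type*} [NormedAddCommGroup E] [NormedSpace ℝ E]
    [FiniteDimensional ℝ E] (A : E →L[ℝ] E) (hA : ∀ v, A v = 0 → v = 0) :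
    ∃ e : E ≃L[ℝ] E, (e : E →L[ℝ] E) = A := by
  have hinj : Function.Injective (A : E →ₗ[ℝ] E) :=
    (injective_iff_map_eq_zero (A : E →ₗ[ℝ] E)).2 hA
  refine ⟨(LinearEquiv.ofInjectiveEndo (A : E →ₗ[ℝ] E) hinj).toContinuousLinearEquiv, ?_⟩
  ext v
  rfl

/-- A smooth perturbation of the identity by a contraction is a diffeomorphism. -/
theorem exists_homeomorph_id_add_of_lipschitzWith {E : Type*} [NormedAddCommGroup E]
    [NormedSpace ℝ E] [FiniteDimensional ℝ E] {g : E → E} (hg : ContDiff ℝ (⊤ : ℕ∞) g)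
    {K : NNReal} (hK : K < 1) (hLip : LipschitzWith K g) :
    ∃ Φ : E ≃ₜ E, (∀ x, Φ x = x + g x) ∧ ContDiff ℝ (⊤ : ℕ∞) Φ ∧
      ContDiff ℝ (⊤ : ℕ∞) Φ.symm := by
  have : CompleteSpace E := FiniteDimensional.complete ℝ E
  have happrox : ApproximatesLinearOn (fun x => x + g x)
      ((ContinuousLinearEquiv.refl ℝ E : E ≃L[ℝ] E) : E →L[ℝ] E) univ K := by
    rw [ApproximatesLinearOn.approximatesLinearOn_iff_lipschitzOnWith]
    have h : (fun x => x + g x) - ⇑((ContinuousLinearEquiv.refl ℝ E : E ≃L[ℝ] E) : E →L[ℝ] E)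
        = g := by
      ext x
      simp
    rw [h]
    exact hLip.lipschitzOnWith
  have hc : Subsingleton E ∨
      K < ‖((ContinuousLinearEquiv.refl ℝ E).symm : E →L[ℝ] E)‖₊⁻¹ := by
    rcases subsingleton_or_nontrivial E with h | h
    · exact Or.inl h
    · right
      have h1 : ‖((ContinuousLinearEquiv.refl ℝ E).symm : E →L[ℝ] E)‖₊ = 1 :=
        NNReal.eq ContinuousLinearMap.norm_id
      rw [h1, inv_one]
      exact hK
  have hsmooth : ContDiff ℝ (⊤ : ℕ∞) (fun x => x + g x) := contDiff_id.add hg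
  have hderiv : ∀ x, ∃ e : E ≃L[ℝ] E,
      HasFDerivAt (fun x => x + g x) (e : E →L[ℝ] E) x := by
    intro x
    have hgx : HasFDerivAt g (fderiv ℝ g x) x :=
      (hg.differentiable (by simp)).differentiableAt.hasFDerivAt
    obtain ⟨e, he⟩ := exists_continuousLinearEquiv_of_ker
      (ContinuousLinearMap.id ℝ E + fderiv ℝ g x) (by
        intro v hv
        have h1 : v = -(fderiv ℝ g x v) := eq_neg_of_add_eq_zero_left hv
        have h2 : ‖v‖ ≤ K * ‖v‖ := by
          calc ‖v‖ = ‖fderiv ℝ g x v‖ := by rw [← norm_neg (fderiv ℝ g x v), ← h1]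
            _ ≤ ‖fderiv ℝ g x‖ * ‖v‖ := ContinuousLinearMap.le_opNorm _ _
            _ ≤ K * ‖v‖ := by
              gcongr
              exact norm_fderiv_le_of_lipschitz ℝ hLip
        have h3 : (K : ℝ) < 1 := hK
        have h4 : ‖v‖ ≤ 0 := by nlinarith [norm_nonneg v]
        exact norm_le_zero_iff.1 h4)
    exact ⟨e, he ▸ (hasFDerivAt_id x).add hgx⟩
  choose e he using hderiv
  refine ⟨happrox.toHomeomorph _ hc, fun x => rfl, hsmooth, ?_⟩
  exact (happrox.toHomeomorph _ hc).contDiff_symm he hsmooth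

/-- Off a closed set `M`, nearby points are exchanged by diffeomorphisms fixing `M`. -/
theorem eventually_exists_diffeo_fixing {n : ℕ} {M : Set (Fin n → ℝ)} (hM : IsClosed M)
    {p : Fin n → ℝ} (hp : p ∉ M) :
    ∀ᶠ q in nhds p, ∃ Φ : (Fin n → ℝ) ≃ₜ (Fin n → ℝ),
      ContDiff ℝ (⊤ : ℕ∞) Φ ∧ ContDiff ℝ (⊤ : ℕ∞) Φ.symm ∧ (∀ x ∈ M, Φ x = x) ∧ Φ q = p := by
  obtain ⟨r, hr, hball⟩ := Metric.isOpen_iff.1 hM.isOpen_compl p hp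
  let φ : ContDiffBump p := ⟨r / 2, r, by positivity, by linarith⟩
  obtain ⟨C, hC⟩ := ContDiff.lipschitzWith_of_hasCompactSupport (𝕂 := ℝ) (n := (⊤ : ℕ∞))
    φ.hasCompactSupport φ.contDiff (by simp)
  have hlim : Filter.Tendsto (fun q => C * ‖p - q‖₊) (nhds p) (nhds 0) := by
    have h : Continuous (fun q => C * ‖p - q‖₊) := by fun_prop
    simpa using h.tendsto p
  filter_upwards [hlim.eventually (gt_mem_nhds zero_lt_one),
    Metric.closedBall_mem_nhds p φ.rIn_pos] with q hq hqball
  have hLip : LipschitzWith (C * ‖p - q‖₊) (fun z => φ z • (p - q)) := by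
    refine LipschitzWith.of_dist_le_mul fun x y => ?_
    rw [dist_eq_norm, ← sub_smul, norm_smul, ← dist_eq_norm]
    push_cast
    calc dist (φ x) (φ y) * ‖p - q‖ ≤ (C * dist x y) * ‖p - q‖ := by
          gcongr
          exact hC.dist_le_mul x y
      _ = C * ‖p - q‖ * dist x y := by ring
  obtain ⟨Φ, hΦ, h1, h2⟩ := exists_homeomorph_id_add_of_lipschitzWith
    (φ.contDiff.smul contDiff_const) hq hLip
  refine ⟨Φ, h1, h2, fun x hx => ?_, ?_⟩
  · have hx0 : φ x = 0 := by
      refine φ.zero_of_le_dist ?_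
      by_contra! hlt
      exact hball (Metric.mem_ball.2 hlt) hx
    simp [hΦ, hx0]
  · simp [hΦ, φ.one_of_mem_closedBall hqball]

theorem SetDiffeo.symm {a b : ℕ} {s : Set (Fin a → ℝ)} {t : Set (Fin b → ℝ)}
    (h : SetDiffeo s t) : SetDiffeo t s := by
  obtain ⟨F, G, hF, hG, hFm, hGm, hinv⟩ := h
  exact ⟨G, F, hG, hF, hGm, hFm, hinv.symm⟩

theorem SetDiffeo.trans {a b d : ℕ} {s : Set (Fin a → ℝ)} {t : Set (Fin b → ℝ)}
    {u : Set (Fin d → ℝ)} (h : SetDiffeo s t) (h' : SetDiffeo t u) : SetDiffeo s u := by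
  obtain ⟨F, G, hF, hG, hFm, hGm, hinv⟩ := h
  obtain ⟨F', G', hF', hG', hFm', hGm', hinv'⟩ := h'
  refine ⟨F' ∘ F, G ∘ G', hF'.comp hF hFm, hG.comp hG' hGm', hFm'.comp hFm, hGm.comp hGm', ?_, ?_⟩
  · intro x hx
    simp [hinv'.1 (hFm hx), hinv.1 hx]
  · intro x hx
    simp [hinv.2 (hGm' hx), hinv'.2 hx]

theorem setDiffeo_image_of_leftInverse {a b : ℕ} {s : Set (Fin a → ℝ)}
    {F : (Fin a → ℝ) → Fin b → ℝ} {G : (Fin b → ℝ) → Fin a → ℝ}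
    (hF : ContDiffOn ℝ (⊤ : ℕ∞) F s) (hG : ContDiffOn ℝ (⊤ : ℕ∞) G (F '' s))
    (hinv : LeftInvOn G F s) : SetDiffeo s (F '' s) :=
  ⟨F, G, hF, hG, mapsTo_image F s, by rintro _ ⟨x, hx, rfl⟩; rwa [hinv hx], hinv,
    by rintro _ ⟨x, hx, rfl⟩; rw [hinv hx]⟩

/-- An open cell that meets `M` in a cell of codimension one. -/
structure IsAdaptedCell {n : ℕ} (M V : Set (Fin n → ℝ)) : Prop where
  isOpen : IsOpen V
  nonempty : (V ∩ M).Nonempty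
  diffeo : SetDiffeo V (unitOpenCube n)
  diffeo_inter : SetDiffeo (V ∩ M) (unitOpenCube (n - 1))

theorem IsAdaptedCell.image {n : ℕ} {M V : Set (Fin n → ℝ)} (h : IsAdaptedCell M V)
    (Φ : (Fin n → ℝ) ≃ₜ (Fin n → ℝ)) (h1 : ContDiff ℝ (⊤ : ℕ∞) Φ)
    (h2 : ContDiff ℝ (⊤ : ℕ∞) Φ.symm) (hfix : ∀ x ∈ M, Φ x = x) : IsAdaptedCell M (Φ '' V) := by
  have hinter : Φ '' V ∩ M = V ∩ M := by
    ext x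
    constructor
    · rintro ⟨⟨y, hy, rfl⟩, hx⟩
      have : y = Φ y := Φ.injective (hfix _ hx).symm
      exact ⟨this ▸ hy, hx⟩
    · rintro ⟨hx, hxM⟩
      exact ⟨⟨x, hx, hfix x hxM⟩, hxM⟩
  refine ⟨Φ.isOpenMap _ h.isOpen, hinter ▸ h.nonempty, ?_, hinter ▸ h.diffeo_inter⟩
  exact (setDiffeo_image_of_leftInverse h1.contDiffOn h2.contDiffOn
    (fun x _ => Φ.symm_apply_apply x)).symm.trans h.diffeo

theorem setDiffeo_ball_unitOpenCube {n : ℕ} (c : Fin n → ℝ) {ε : ℝ} (hε : 0 < ε) :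
    SetDiffeo (Metric.ball c ε) (unitOpenCube n) := by
  refine ⟨fun x j => (x j - c j) / (2 * ε) + 1 / 2, fun y j => c j + 2 * ε * (y j - 1 / 2),
    ?_, ?_, ?_, ?_, ?_, ?_⟩
  · exact ContDiff.contDiffOn (by fun_prop)
  · exact ContDiff.contDiffOn (by fun_prop)
  · intro x hx j
    have h := (dist_pi_lt_iff hε).1 (Metric.mem_ball.1 hx) j
    rw [Real.dist_eq, abs_lt] at h
    constructor
    · have : -(1 / 2) < (x j - c j) / (2 * ε) := by
        rw [lt_div_iff₀ (by positivity)]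
        linarith
      linarith
    · have : (x j - c j) / (2 * ε) < 1 / 2 := by
        rw [div_lt_iff₀ (by positivity)]
        linarith
      linarith
  · intro y hy
    refine Metric.mem_ball.2 ((dist_pi_lt_iff hε).2 fun j => ?_)
    have h := hy j
    rw [Real.dist_eq, abs_lt]
    constructor <;> nlinarith [h.1, h.2]
  · intro x _
    ext j
    field_simp
    ring
  · intro y _
    ext j
    field_simp
    ring

theorem setDiffeo_slice_ball {k : ℕ} (i : Fin (k + 1)) (c : Fin (k + 1) → ℝ) (ε : ℝ)
    (hε : 0 < ε) :
    SetDiffeo (Metric.ball c ε ∩ {x | x i = c i}) (Metric.ball (fun j => c (i.succAbove j)) ε) := by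
  refine ⟨fun x j => x (i.succAbove j), fun y => i.insertNth (c i) y, ?_, ?_, ?_, ?_, ?_, ?_⟩
  · exact ContDiff.contDiffOn (by fun_prop)
  · refine ContDiff.contDiffOn (contDiff_pi.2 fun j => ?_)
    induction j using i.succAboveCases with
    | x => simpa using contDiff_const
    | p j => simpa using contDiff_apply ℝ ℝ j
  · rintro x ⟨hx, -⟩
    refine Metric.mem_ball.2 ((dist_pi_lt_iff hε).2 fun j => ?_)
    exact (dist_pi_lt_iff hε).1 (Metric.mem_ball.1 hx) _
  · intro y hy
    refine ⟨Metric.mem_ball.2 ((dist_pi_lt_iff hε).2 fun j => ?_), by simp⟩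
    induction j using i.succAboveCases with
    | x => simpa using hε
    | p j => simpa using (dist_pi_lt_iff hε).1 (Metric.mem_ball.1 hy) j
  · rintro x ⟨-, hx⟩
    ext j
    induction j using i.succAboveCases with
    | x => simpa using hx.symm
    | p j => simp
  · intro y _
    ext j
    simp

theorem hasFDerivAt_update_self {n : ℕ} (i : Fin n) {F : (Fin n → ℝ) → ℝ} {z : Fin n → ℝ}
    {F' : (Fin n → ℝ) →L[ℝ] ℝ} (hF : HasFDerivAt F F' z) (hi : F' (Pi.single i 1) ≠ 0) :
    ∃ e : (Fin n → ℝ) ≃L[ℝ] (Fin n → ℝ),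
      HasFDerivAt (fun x => Function.update x i (F x)) (e : (Fin n → ℝ) →L[ℝ] Fin n → ℝ) z := by
  let A : (Fin n → ℝ) →L[ℝ] Fin n → ℝ := ContinuousLinearMap.pi fun j =>
    if j = i then F' else ContinuousLinearMap.proj j
  have hA : ∀ v, A v = 0 → v = 0 := by
    intro v hv
    have hne : ∀ j, j ≠ i → v j = 0 := by
      intro j hj
      simpa [A, hj] using congrFun hv j
    have hvi : v = v i • Pi.single i (1 : ℝ) := by
      ext j
      by_cases hj : j = i
      · subst hj; simp
      · simp [hj, hne j hj]
    have h0 : F' v = 0 := by simpa [A] using congrFun hv i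
    rw [hvi, map_smul, smul_eq_mul] at h0
    have h1 : v i = 0 := (mul_eq_zero.1 h0).resolve_right hi
    rw [hvi, h1, zero_smul]
  obtain ⟨e, he⟩ := exists_continuousLinearEquiv_of_ker A hA
  refine ⟨e, he ▸ hasFDerivAt_pi.2 fun j => ?_⟩
  by_cases hj : j = i
  · subst hj
    simpa using hF
  · simpa [hj] using hasFDerivAt_apply (𝕜 := ℝ) j z

/-- Near every point of a smooth hypersurface there is an adapted cell. -/
theorem IsSmoothHypersurface.exists_isAdaptedCell {n : ℕ} {M : Set (Fin n → ℝ)}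
    (hM : IsSmoothHypersurface M) {q : Fin n → ℝ} (hq : q ∈ M) :
    ∃ W, IsAdaptedCell M W ∧ q ∈ W := by
  obtain ⟨V, hV, hqV, F, hF, hF', hMV⟩ := hM q hq
  have hFq : F q = 0 := (hMV ▸ (⟨hq, hqV⟩ : q ∈ M ∩ V) : q ∈ {y ∈ V | F y = 0}).2
  obtain ⟨i, hi⟩ : ∃ i, fderiv ℝ F q (Pi.single i 1) ≠ 0 := by
    by_contra! h
    refine hF' q hqV (ContinuousLinearMap.coe_injective ((Pi.basisFun ℝ (Fin n)).ext fun i => ?_))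
    simpa using h i
  have hFd : ∀ z, HasFDerivAt F (fderiv ℝ F z) z := fun z =>
    (hF.differentiable (by simp)).differentiableAt.hasFDerivAt
  set h : (Fin n → ℝ) → Fin n → ℝ := fun x => Function.update x i (F x) with hh
  have hsmooth : ContDiff ℝ (⊤ : ℕ∞) h := by
    refine contDiff_pi.2 fun j => ?_
    by_cases hj : j = i
    · subst hj
      simpa [hh] using hF
    · simpa [hh, hj] using contDiff_apply ℝ ℝ j
  obtain ⟨e₀, he₀⟩ := hasFDerivAt_update_self i (hFd q) hi
  let E := hsmooth.contDiffAt.toOpenPartialHomeomorph h he₀ (by simp)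
  have hEq : q ∈ E.source := hsmooth.contDiffAt.mem_toOpenPartialHomeomorph_source he₀ (by simp)
  have hO : IsOpen {z | fderiv ℝ F z (Pi.single i 1) ≠ 0} :=
    isOpen_ne_fun ((hF.continuous_fderiv (by simp)).clm_apply continuous_const) continuous_const
  let E' := E.restrOpen (V ∩ {z | fderiv ℝ F z (Pi.single i 1) ≠ 0}) (hV.inter hO)
  have hE'q : q ∈ E'.source := ⟨hEq, hqV, hi⟩
  have hE'h : ∀ z, E' z = h z := fun z => rfl
  obtain ⟨ε, hε, hball⟩ := Metric.isOpen_iff.1 E'.open_target (h q) (E'.map_source hE'q)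
  have hsymm : ContDiffOn ℝ (⊤ : ℕ∞) E'.symm E'.target := by
    intro y hy
    obtain ⟨e, he⟩ := hasFDerivAt_update_self i (hFd (E'.symm y)) (E'.map_target hy).2.2
    exact (E'.contDiffAt_symm hy he hsmooth.contDiffAt).contDiffWithinAt
  have hcell : ∀ T ⊆ Metric.ball (h q) ε, SetDiffeo (E'.symm '' T) T := fun T hT =>
    (setDiffeo_image_of_leftInverse (hsymm.mono (hT.trans hball)) hsmooth.contDiffOn
      (fun y hy => E'.right_inv (hball (hT hy)))).symm
  have hqi : h q i = 0 := by simp [hh, hFq]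
  have hinter : E'.symm '' Metric.ball (h q) ε ∩ M =
      E'.symm '' (Metric.ball (h q) ε ∩ {x | x i = h q i}) := by
    have key : ∀ y ∈ Metric.ball (h q) ε, (E'.symm y ∈ M ↔ y i = h q i) := by
      intro y hy
      have hyV : E'.symm y ∈ V := (E'.map_target (hball hy)).2.1
      have h1 : F (E'.symm y) = y i := by
        have := congrFun (E'.right_inv (hball hy)) i
        rw [hE'h] at this
        simpa [hh] using this
      rw [hqi, ← h1]
      have h2 : E'.symm y ∈ M ∩ V ↔ E'.symm y ∈ {y ∈ V | F y = 0} := by rw [hMV]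
      simpa [hyV] using h2
    ext x
    constructor
    · rintro ⟨⟨y, hy, rfl⟩, hx⟩
      exact ⟨y, ⟨hy, (key y hy).1 hx⟩, rfl⟩
    · rintro ⟨y, ⟨hy, hyi⟩, rfl⟩
      exact ⟨⟨y, hy, rfl⟩, (key y hy).2 hyi⟩
  have hqW : q ∈ E'.symm '' Metric.ball (h q) ε :=
    ⟨h q, Metric.mem_ball_self hε, E'.left_inv hE'q⟩
  refine ⟨E'.symm '' Metric.ball (h q) ε, ⟨?_, ⟨q, hqW, hq⟩, ?_, ?_⟩, hqW⟩
  · exact E'.symm.isOpen_image_of_subset_source Metric.isOpen_ball hball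
  · exact (hcell _ subset_rfl).trans (setDiffeo_ball_unitOpenCube _ hε)
  · rw [hinter]
    cases n with
    | zero => exact i.elim0
    | succ k =>
      exact ((hcell _ inter_subset_left).trans (setDiffeo_slice_ball i _ ε hε)).trans
        (setDiffeo_ball_unitOpenCube _ hε)

/-- Adapted cells of a nonempty closed smooth hypersurface cover the whole space. -/
theorem IsSmoothHypersurface.exists_isAdaptedCell_mem {n : ℕ} {M : Set (Fin n → ℝ)}
    (hM : IsSmoothHypersurface M) (hclosed : IsClosed M) (hne : M.Nonempty) (p : Fin n → ℝ) :
    ∃ W, IsAdaptedCell M W ∧ p ∈ W := by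
  let G : Set (Fin n → ℝ) := {p | ∃ W, IsAdaptedCell M W ∧ p ∈ W}
  have hMG : M ⊆ G := fun q hq => hM.exists_isAdaptedCell hq
  have hGopen : IsOpen G := by
    refine isOpen_iff_mem_nhds.2 ?_
    rintro x ⟨W, hW, hx⟩
    exact Filter.mem_of_superset (hW.isOpen.mem_nhds hx) fun y hy => ⟨W, hW, hy⟩
  have hGclosed : IsClosed G := by
    refine isClosed_of_closure_subset fun x hx => ?_
    by_cases hxM : x ∈ M
    · exact hMG hxM
    · obtain ⟨y, ⟨Φ, h1, h2, hfix, rfl⟩, W, hW, hy⟩ := mem_closure_iff_nhds.1 hx _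
        (eventually_exists_diffeo_fixing hclosed hxM)
      exact ⟨Φ '' W, hW.image Φ h1 h2 hfix, mem_image_of_mem _ hy⟩
  have hG : G = univ := IsClopen.eq_univ ⟨hGclosed, hGopen⟩ (hne.mono hMG)
  exact (hG ▸ mem_univ p : p ∈ G)

/-- **Covering lemma.**  Let `U ⊂ ℝⁿ` (`n ≥ 2`) be a bounded connected open set with
connected `C^∞` boundary and `B` an open ball containing `closure U`.  Then `B` admits a
finite open cover `U₀, …, U_m` such that each `U_j` is diffeomorphic to `(0,1)ⁿ`, meets
`∂U`, and `U_j ∩ ∂U` is diffeomorphic to `(0,1)^(n-1)`. -/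
theorem covering_lemma (n : ℕ) (hn : 2 ≤ n)
    (U : Set (Fin n → ℝ)) (hUopen : IsOpen U) (hUconn : IsConnected U)
    (hUbdd : Bornology.IsBounded U)
    (hbconn : IsConnected (frontier U)) (hbsmooth : IsSmoothHypersurface (frontier U))
    (c : Fin n → ℝ) (R : ℝ) (hBU : closure U ⊆ Metric.ball c R) :
    ∃ m : ℕ, ∃ V : Fin (m + 1) → Set (Fin n → ℝ),
      (∀ j, IsOpen (V j)) ∧
      Metric.ball c R ⊆ ⋃ j, V j ∧
      (∀ j, (V j ∩ frontier U).Nonempty) ∧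
      (∀ j, SetDiffeo (V j) (unitOpenCube n)) ∧
      (∀ j, SetDiffeo (V j ∩ frontier U) (unitOpenCube (n - 1))) := by
  choose W hW hpW using hbsmooth.exists_isAdaptedCell_mem isClosed_frontier hbconn.nonempty
  obtain ⟨t, ht⟩ := (isCompact_closedBall c R).elim_finite_subcover W
    (fun p => (hW p).isOpen) (fun p _ => mem_iUnion.2 ⟨p, hpW p⟩)
  have hcover : ∀ x ∈ Metric.ball c R, ∃ p ∈ t, x ∈ W p := fun x hx => by
    simpa using ht (Metric.ball_subset_closedBall hx)
  obtain ⟨x, hx⟩ := hUconn.nonempty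
  obtain ⟨p, hp, -⟩ := hcover x (hBU (subset_closure hx))
  obtain ⟨m, hm⟩ := Nat.exists_eq_succ_of_ne_zero (Finset.card_ne_zero_of_mem hp)
  let e : Fin (m + 1) ≃ t := (t.equivFinOfCardEq hm).symm
  refine ⟨m, fun j => W (e j), fun j => (hW _).isOpen, fun y hy => ?_,
    fun j => (hW _).nonempty, fun j => (hW _).diffeo, fun j => (hW _).diffeo_inter⟩
  obtain ⟨p, hp, hyp⟩ := hcover y hy
  exact mem_iUnion.2 ⟨e.symm ⟨p, hp⟩, by simpa using hyp⟩
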